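/- arXiv:1805.11290 — 2 statements merged into one kernel-verified Lean document; each statement's English description precedes it below -/
import Mathlib

section
/- Let λ > 0, let H_α : [0, ℓ_α] × ℝ → ℝ be continuous for each α ∈ 𝒜, and let f ∈ PC(Γ). Suppose v ∈ C²(Γ) satisfies −μ_α v_α''(y) + H_α(y, v_α'(y)) + λ v_α(y) = f_α(y) for all y ∈ (0, ℓ_α) and all α ∈ 𝒜, together with the Kirchhoff conditions ∑_{α∈𝒜_i} γ_iα μ_α ∂_α v(ν_i) = 0 at every vertex ν_i, i ∈ I. Then λ · sup_{α∈𝒜} sup_{y∈[0,ℓ_α]} |v_α(y)| ≤ max_{α∈𝒜} max_{y∈[0,ℓ_α]} |f_α(y) − H_α(y, 0)|. -/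
open Set

/-- A connected network: finite vertex set `I`, finite edge set `A`, each edge `α`
identified with `[0, ℓ α]`, with endpoint `0` attached to `src α` and endpoint `ℓ α`
attached to `tgt α`, these being distinct vertices; the resulting graph is connected. -/
structure Network (I A : Type) [Fintype I] [Fintype A] [DecidableEq I] where
  ℓ : A → ℝ
  ℓ_pos : ∀ α, 0 < ℓ α
  src : A → I
  tgt : A → I
  src_ne_tgt : ∀ α, src α ≠ tgt α
  connected : ∀ i j : I,
    Relation.ReflTransGen
      (fun i j => ∃ α, (src α = i ∧ tgt α = j) ∨ (src α = j ∧ tgt α = i)) i j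

namespace Network

variable {I A : Type} [Fintype I] [Fintype A] [DecidableEq I]

/-- The set `𝒜_i` of edges incident to the vertex `i`. -/
def edges (N : Network I A) (i : I) : Finset A :=
  Finset.univ.filter fun α => N.src α = i ∨ N.tgt α = i

/-- The value `f|_α(ν_i)` of an edgewise family `f` at the vertex `i` along the edge `α`. -/
def vval (N : Network I A) (f : A → ℝ → ℝ) (i : I) (α : A) : ℝ :=
  if N.src α = i then f α 0 else f α (N.ℓ α)

/-- The outward directional derivative `∂_α f(ν_i)`, expressed via the family `f'` of
edgewise first derivatives. -/
def oderiv (N : Network I A) (f' : A → ℝ → ℝ) (i : I) (α : A) : ℝ :=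
  if N.src α = i then -(f' α 0) else f' α (N.ℓ α)

/-- The sign `n_{iα}`: `-1` if `ν_i` is attached to the endpoint `0` of `α`, `+1` if it is
attached to the endpoint `ℓ α`. -/
def sgn (N : Network I A) (i : I) (α : A) : ℝ :=
  if N.src α = i then -1 else 1

/-- `v = (v_α)` is a `C²` function on the network, with first derivatives `v'` and second
derivatives `v''`, continuous at the vertices. -/
def IsC2 (N : Network I A) (v v' v'' : A → ℝ → ℝ) : Prop :=
  (∀ α, ∀ y ∈ Icc (0:ℝ) (N.ℓ α), HasDerivWithinAt (v α) (v' α y) (Icc 0 (N.ℓ α)) y) ∧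
  (∀ α, ∀ y ∈ Icc (0:ℝ) (N.ℓ α), HasDerivWithinAt (v' α) (v'' α y) (Icc 0 (N.ℓ α)) y) ∧
  (∀ α, ContinuousOn (v'' α) (Icc 0 (N.ℓ α))) ∧
  (∀ i : I, ∀ α ∈ N.edges i, ∀ β ∈ N.edges i, N.vval v i α = N.vval v i β)

/-- The Kirchhoff conditions `∑_{α ∈ 𝒜_i} γ_{iα} μ_α ∂_α v(ν_i) = 0` at every vertex. -/
def Kirchhoff (N : Network I A) (μ : A → ℝ) (γ : I → A → ℝ) (v' : A → ℝ → ℝ) : Prop :=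
  ∀ i : I, ∑ α ∈ N.edges i, γ i α * μ α * N.oderiv v' i α = 0

end Network

namespace Network

variable {I A : Type} [Fintype I] [Fintype A] [DecidableEq I]

/-- A solution of the stationary Fokker–Planck problem on the network associated with the
drift `b`: `m` (with edgewise derivative `m'`) is `C¹` on each edge, satisfies the jump
conditions `m|_α(ν_i)/γ_{iα} = m|_β(ν_i)/γ_{iβ}`, the first integral
`μ_α m_α' + b_α m_α = c_α` on each edge, the vertex transmission conditions
`∑_{α ∈ 𝒜_i} [n_{iα} b|_α(ν_i) m|_α(ν_i) + μ_α ∂_α m(ν_i)] = 0`, is nonnegative and has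
total integral `1`. -/
def IsFPSolution (N : Network I A) (μ : A → ℝ) (γ : I → A → ℝ)
    (b : A → ℝ → ℝ) (m m' : A → ℝ → ℝ) : Prop :=
  (∀ α, ∀ y ∈ Icc (0:ℝ) (N.ℓ α), HasDerivWithinAt (m α) (m' α y) (Icc 0 (N.ℓ α)) y) ∧
  (∀ α, ContinuousOn (m' α) (Icc 0 (N.ℓ α))) ∧
  (∀ i : I, ∀ α ∈ N.edges i, ∀ β ∈ N.edges i,
      N.vval m i α / γ i α = N.vval m i β / γ i β) ∧
  (∀ α, ∃ c : ℝ, ∀ y ∈ Icc (0:ℝ) (N.ℓ α), μ α * m' α y + b α y * m α y = c) ∧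
  (∀ i : I, ∑ α ∈ N.edges i,
      (N.sgn i α * N.vval b i α * N.vval m i α + μ α * N.oderiv m' i α) = 0) ∧
  (∀ α, ∀ y ∈ Icc (0:ℝ) (N.ℓ α), 0 ≤ m α y) ∧
  (∑ α : A, ∫ y in (0:ℝ)..(N.ℓ α), m α y) = 1

/-- The standing assumptions on the Hamiltonians `H_α : [0, ℓ_α] × ℝ → ℝ` with partial
derivatives `Hp_α = ∂_p H_α`: `C¹` regularity, convexity in `p`, coercivity
`H_α(x,p) ≥ C₀|p|^q − C₁` and the growth condition `|∂_p H_α(x,p)| ≤ C₂(|p|^{q−1} + 1)`. -/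
def HamHyp (N : Network I A) (H Hp : A → ℝ → ℝ → ℝ) (q C0 C1 C2 : ℝ) : Prop :=
  (∀ α, ContDiffOn ℝ 1 (fun z : ℝ × ℝ => H α z.1 z.2)
      (Icc (0:ℝ) (N.ℓ α) ×ˢ (univ : Set ℝ))) ∧
  (∀ α, ∀ x ∈ Icc (0:ℝ) (N.ℓ α), ∀ p : ℝ, HasDerivAt (fun p => H α x p) (Hp α x p) p) ∧
  (∀ α, ∀ x ∈ Icc (0:ℝ) (N.ℓ α), ConvexOn ℝ univ (fun p => H α x p)) ∧
  (∀ α, ∀ x ∈ Icc (0:ℝ) (N.ℓ α), ∀ p : ℝ, C0 * |p| ^ q - C1 ≤ H α x p) ∧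
  (∀ α, ∀ x ∈ Icc (0:ℝ) (N.ℓ α), ∀ p : ℝ, |Hp α x p| ≤ C2 * (|p| ^ (q - 1) + 1))

/-- A solution `(v, m, ρ)` of the stationary MFG system on the network: `v` is `C²`,
solves the ergodic HJB equation with coupling `F(m)` and the Kirchhoff conditions; `m` is
`C¹` on each edge, satisfies the jump conditions, the first-integral form of the
Fokker–Planck equation `μ_α m_α' + m_α ∂_p H_α(·, v_α') = c_α` with `∑_{α∈𝒜_i} n_{iα} c_α = 0`
at every vertex, `m ≥ 0`, `∫_Γ m = 1` and `∫_Γ v = 0`. -/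
def IsMFGSolution (N : Network I A) (μ : A → ℝ) (γ : I → A → ℝ)
    (H Hp : A → ℝ → ℝ → ℝ) (F : ℝ → ℝ)
    (v v' v'' m m' : A → ℝ → ℝ) (ρ : ℝ) : Prop :=
  IsC2 N v v' v'' ∧
  (∀ α, ∀ y ∈ Ioo (0:ℝ) (N.ℓ α),
      -(μ α * v'' α y) + H α y (v' α y) + ρ = F (m α y)) ∧
  Kirchhoff N μ γ v' ∧
  (∀ α, ∀ y ∈ Icc (0:ℝ) (N.ℓ α), HasDerivWithinAt (m α) (m' α y) (Icc 0 (N.ℓ α)) y) ∧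
  (∀ α, ContinuousOn (m' α) (Icc 0 (N.ℓ α))) ∧
  (∀ i : I, ∀ α ∈ N.edges i, ∀ β ∈ N.edges i,
      N.vval m i α / γ i α = N.vval m i β / γ i β) ∧
  (∃ c : A → ℝ,
    (∀ α, ∀ y ∈ Icc (0:ℝ) (N.ℓ α), μ α * m' α y + m α y * Hp α y (v' α y) = c α) ∧
    (∀ i : I, ∑ α ∈ N.edges i, N.sgn i α * c α = 0)) ∧
  (∀ α, ∀ y ∈ Icc (0:ℝ) (N.ℓ α), 0 ≤ m α y) ∧
  (∑ α : A, ∫ y in (0:ℝ)..(N.ℓ α), m α y) = 1 ∧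
  (∑ α : A, ∫ y in (0:ℝ)..(N.ℓ α), v α y) = 0

end Network

/-- First-order necessary condition at a maximum over a compact interval, endpoints included. -/
theorem mul_sub_nonpos_of_isMaxOn_Icc {a b x d : ℝ} {u : ℝ → ℝ}
    (hx : x ∈ Icc a b) (hu : HasDerivWithinAt u d (Icc a b) x)
    (hmax : ∀ y ∈ Icc a b, u y ≤ u x) {y : ℝ} (hy : y ∈ Icc a b) : d * (y - x) ≤ 0 := by
  have hloc : IsLocalMaxOn u (Icc a b) x := IsMaxOn.localize (fun z hz => hmax z hz)
  have h := hloc.hasFDerivWithinAt_nonpos hu.hasFDerivWithinAt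
    (sub_mem_posTangentConeAt_of_segment_subset ((convex_Icc a b).segment_subset hx hy))
  simpa [mul_comm] using h

/-- Second-order necessary condition at a critical maximum over a compact interval,
endpoints included. -/
theorem second_deriv_nonpos_of_isMaxOn_Icc {a b x c : ℝ} {u u' : ℝ → ℝ} (hab : a < b)
    (hx : x ∈ Icc a b) (hu : ∀ y ∈ Icc a b, HasDerivWithinAt u (u' y) (Icc a b) y)
    (hu' : HasDerivWithinAt u' c (Icc a b) x)
    (hmax : ∀ y ∈ Icc a b, u y ≤ u x) (hcrit : u' x = 0) : c ≤ 0 := by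
  by_contra! hc
  have hslope := (hasDerivWithinAt_iff_tendsto_slope.mp hu').eventually (lt_mem_nhds hc)
  obtain ⟨ε, hε, hball⟩ := Metric.mem_nhdsWithin_iff.mp hslope
  have hpos : ∀ y ∈ Icc a b, y ≠ x → |y - x| < ε → 0 < u' y / (y - x) := by
    intro y hy hne hd
    have h : 0 < slope u' x y := hball ⟨by rwa [Metric.mem_ball, Real.dist_eq], hy, hne⟩
    rwa [slope_def_field, hcrit, sub_zero] at h
  have hderiv : ∀ y ∈ Ioo a b, HasDerivAt u (u' y) y := fun y hy =>
    (hu y (Ioo_subset_Icc_self hy)).hasDerivAt (Icc_mem_nhds hy.1 hy.2)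
  have hcont : ContinuousOn u (Icc a b) := fun y hy => (hu y hy).continuousWithinAt
  obtain ⟨hax, hxb⟩ := hx
  rcases hxb.lt_or_eq with hlt | heq
  · obtain ⟨y, hxy, hy⟩ := exists_between (lt_min hlt (lt_add_of_pos_right x hε))
    obtain ⟨hyb, hyε⟩ := lt_min_iff.mp hy
    obtain ⟨ξ, ⟨hξ1, hξ2⟩, hξ⟩ := exists_hasDerivAt_eq_slope u u' hxy
      (hcont.mono (Icc_subset_Icc hax hyb.le))
      (fun z hz => hderiv z ⟨hax.trans_lt hz.1, hz.2.trans hyb⟩)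
    have hp := hpos ξ ⟨by linarith, by linarith⟩ hξ1.ne' (by rw [abs_lt]; constructor <;> linarith)
    have hξpos : 0 < u' ξ := by
      simpa using (div_pos_iff_of_pos_right (sub_pos.mpr hξ1)).mp hp
    rw [hξ, div_pos_iff_of_pos_right (sub_pos.mpr hxy)] at hξpos
    linarith [hmax y ⟨by linarith, by linarith⟩]
  · obtain ⟨y, hy, hyx⟩ := exists_between (max_lt (heq ▸ hab : a < x) (sub_lt_self x hε))
    obtain ⟨hay, hyε⟩ := max_lt_iff.mp hy
    obtain ⟨ξ, ⟨hξ1, hξ2⟩, hξ⟩ := exists_hasDerivAt_eq_slope u u' hyx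
      (hcont.mono (Icc_subset_Icc hay.le hxb))
      (fun z hz => hderiv z ⟨hay.trans hz.1, hz.2.trans_le hxb⟩)
    have hp := hpos ξ ⟨by linarith, by linarith⟩ hξ2.ne (by rw [abs_lt]; constructor <;> linarith)
    have hξneg : u' ξ < 0 := by
      rcases div_pos_iff.mp hp with h | h
      · linarith [h.2]
      · exact h.1
    rw [hξ, div_neg_iff] at hξneg
    have hle := hmax y ⟨by linarith, by linarith⟩
    rcases hξneg with h | h <;> linarith [h.1, h.2]

namespace Network

variable {I A : Type} [Fintype I] [Fintype A] [DecidableEq I]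

/-- If `v` attains its maximum over the network at the vertex `i`, then the Kirchhoff condition
at `i` forces all the outward derivatives at `i` to vanish. -/
theorem oderiv_eq_zero_of_max {N : Network I A} {μ : A → ℝ} {γ : I → A → ℝ}
    (hμ : ∀ α, 0 < μ α) (hγ : ∀ i : I, ∀ α ∈ N.edges i, 0 < γ i α)
    {v v' v'' : A → ℝ → ℝ} (hv : N.IsC2 v v' v'') (hkir : N.Kirchhoff μ γ v')
    {i : I} {α : A} (hα : α ∈ N.edges i)
    (hmax : ∀ β, ∀ y ∈ Icc (0 : ℝ) (N.ℓ β), v β y ≤ N.vval v i α) :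
    N.oderiv v' i α = 0 := by
  have hnonneg : ∀ β ∈ N.edges i, 0 ≤ N.oderiv v' i β := by
    intro β hβ
    have hℓ := N.ℓ_pos β
    have hl : (0 : ℝ) ∈ Icc 0 (N.ℓ β) := left_mem_Icc.mpr hℓ.le
    have hr : N.ℓ β ∈ Icc 0 (N.ℓ β) := right_mem_Icc.mpr hℓ.le
    have hm := hmax β
    rw [hv.2.2.2 i α hα β hβ] at hm
    unfold vval at hm
    unfold oderiv
    split_ifs at hm ⊢
    · have h := mul_sub_nonpos_of_isMaxOn_Icc hl (hv.1 β 0 hl) hm hr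
      nlinarith
    · have h := mul_sub_nonpos_of_isMaxOn_Icc hr (hv.1 β _ hr) hm hl
      nlinarith
  have hpos : ∀ β ∈ N.edges i, 0 < γ i β * μ β := fun β hβ => mul_pos (hγ i β hβ) (hμ β)
  have hzero := (Finset.sum_eq_zero_iff_of_nonneg fun β hβ =>
    mul_nonneg (hpos β hβ).le (hnonneg β hβ)).mp (hkir i) α hα
  exact (mul_eq_zero.mp hzero).resolve_left (hpos α hα).ne'

/-- The derivative vanishes at every point where `v` attains its maximum over the network. -/
theorem deriv_eq_zero_of_max {N : Network I A} {μ : A → ℝ} {γ : I → A → ℝ}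
    (hμ : ∀ α, 0 < μ α) (hγ : ∀ i : I, ∀ α ∈ N.edges i, 0 < γ i α)
    {v v' v'' : A → ℝ → ℝ} (hv : N.IsC2 v v' v'') (hkir : N.Kirchhoff μ γ v')
    {α : A} {x : ℝ} (hx : x ∈ Icc (0 : ℝ) (N.ℓ α))
    (hmax : ∀ β, ∀ y ∈ Icc (0 : ℝ) (N.ℓ β), v β y ≤ v α x) : v' α x = 0 := by
  have hℓ := N.ℓ_pos α
  rcases hx.1.eq_or_lt with rfl | hx0
  · simpa [oderiv] using oderiv_eq_zero_of_max hμ hγ hv hkir (i := N.src α) (α := α)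
      (by simp [edges]) (by simpa [vval] using hmax)
  · rcases hx.2.eq_or_lt with rfl | hxℓ
    · simpa [oderiv, N.src_ne_tgt] using
        oderiv_eq_zero_of_max hμ hγ hv hkir (i := N.tgt α) (α := α)
          (by simp [edges]) (by simpa [vval, N.src_ne_tgt] using hmax)
    · have h0 := mul_sub_nonpos_of_isMaxOn_Icc hx (hv.1 α x hx) (hmax α) (left_mem_Icc.mpr hℓ.le)
      have h1 := mul_sub_nonpos_of_isMaxOn_Icc hx (hv.1 α x hx) (hmax α) (right_mem_Icc.mpr hℓ.le)
      apply le_antisymm <;> nlinarith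

/-- A function in `C²(Γ)` attains its maximum over a nonempty network. -/
theorem exists_max [Nonempty A] {N : Network I A} {v v' v'' : A → ℝ → ℝ}
    (hv : N.IsC2 v v' v'') :
    ∃ α, ∃ x ∈ Icc (0 : ℝ) (N.ℓ α), ∀ β, ∀ y ∈ Icc (0 : ℝ) (N.ℓ β), v β y ≤ v α x := by
  have hedge : ∀ α, ∃ x ∈ Icc (0 : ℝ) (N.ℓ α), IsMaxOn (v α) (Icc 0 (N.ℓ α)) x := fun α =>
    isCompact_Icc.exists_isMaxOn (nonempty_Icc.mpr (N.ℓ_pos α).le)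
      fun y hy => (hv.1 α y hy).continuousWithinAt
  choose x hx hxmax using hedge
  obtain ⟨α, hα⟩ := Finite.exists_max fun α => v α (x α)
  exact ⟨α, x α, hx α, fun β y hy => (hxmax β hy).trans (hα β)⟩

/-- One-sided maximum principle for `−μ_α v'' + H_α(y, v') + λ v = f` with Kirchhoff
conditions. -/
theorem mul_le_of_source_le {N : Network I A} {μ : A → ℝ} {γ : I → A → ℝ}
    (hμ : ∀ α, 0 < μ α) (hγ : ∀ i : I, ∀ α ∈ N.edges i, 0 < γ i α)
    {lam : ℝ} (hlam : 0 < lam) {H : A → ℝ → ℝ → ℝ}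
    (hHcont : ∀ α, ContinuousOn (fun z : ℝ × ℝ => H α z.1 z.2)
      (Icc (0:ℝ) (N.ℓ α) ×ˢ (univ : Set ℝ)))
    {f : A → ℝ → ℝ} (hf : ∀ α, ContinuousOn (f α) (Icc (0:ℝ) (N.ℓ α)))
    {v v' v'' : A → ℝ → ℝ} (hv : N.IsC2 v v' v'')
    (hode : ∀ α : A, ∀ y ∈ Ioo (0:ℝ) (N.ℓ α),
      -(μ α * v'' α y) + H α y (v' α y) + lam * v α y = f α y)
    (hkir : N.Kirchhoff μ γ v') {C : ℝ}
    (hC : ∀ α : A, ∀ y ∈ Icc (0:ℝ) (N.ℓ α), f α y - H α y 0 ≤ C)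
    (α : A) {y : ℝ} (hy : y ∈ Icc (0:ℝ) (N.ℓ α)) : lam * v α y ≤ C := by
  have : Nonempty A := ⟨α⟩
  obtain ⟨β, x, hx, hmax⟩ := exists_max hv
  have hcrit : v' β x = 0 := deriv_eq_zero_of_max hμ hγ hv hkir hx hmax
  have hsecond : v'' β x ≤ 0 := second_deriv_nonpos_of_isMaxOn_Icc (N.ℓ_pos β) hx
    (hv.1 β) (hv.2.1 β x hx) (hmax β) hcrit
  have hvc : ContinuousOn (v β) (Icc 0 (N.ℓ β)) := fun z hz => (hv.1 β z hz).continuousWithinAt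
  have hvc' : ContinuousOn (v' β) (Icc 0 (N.ℓ β)) :=
    fun z hz => (hv.2.1 β z hz).continuousWithinAt
  have hHc : ContinuousOn (fun z => H β z (v' β z)) (Icc 0 (N.ℓ β)) :=
    (hHcont β).comp (f := fun z => (z, v' β z)) (continuousOn_id.prodMk hvc')
      fun z hz => ⟨hz, mem_univ _⟩
  have hclosed : EqOn (fun z => -(μ β * v'' β z) + H β z (v' β z) + lam * v β z) (f β)
      (Icc 0 (N.ℓ β)) :=
    EqOn.of_subset_closure (s := Ioo 0 (N.ℓ β)) (fun z hz => hode β z hz)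
      (((continuousOn_const.mul (hv.2.2.1 β)).neg.add hHc).add (continuousOn_const.mul hvc))
      (hf β) Ioo_subset_Icc_self (closure_Ioo (N.ℓ_pos β).ne).ge
  have heq := hclosed hx
  simp only [hcrit] at heq
  have hμv : μ β * v'' β x ≤ 0 := mul_nonpos_of_nonneg_of_nonpos (hμ β).le hsecond
  have hle : lam * v α y ≤ lam * v β x := mul_le_mul_of_nonneg_left (hmax α y hy) hlam.le
  linarith [hC β x hx]

theorem IsC2.neg {N : Network I A} {v v' v'' : A → ℝ → ℝ} (hv : N.IsC2 v v' v'') :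
    N.IsC2 (-v) (-v') (-v'') := by
  refine ⟨fun α y hy => (hv.1 α y hy).neg, fun α y hy => (hv.2.1 α y hy).neg,
    fun α => (hv.2.2.1 α).neg, fun i α hα β hβ => ?_⟩
  have hneg : ∀ δ, N.vval (-v) i δ = -N.vval v i δ := by
    intro δ
    unfold vval
    split_ifs <;> rfl
  rw [hneg, hneg, hv.2.2.2 i α hα β hβ]

theorem Kirchhoff.neg {N : Network I A} {μ : A → ℝ} {γ : I → A → ℝ} {v' : A → ℝ → ℝ}
    (h : N.Kirchhoff μ γ v') : N.Kirchhoff μ γ (-v') := by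
  intro i
  have hneg : ∀ δ, N.oderiv (-v') i δ = -N.oderiv v' i δ := by
    intro δ
    unfold oderiv
    split_ifs <;> simp
  simp only [hneg, mul_neg, Finset.sum_neg_distrib, h i, neg_zero]

end Network

/-- `L^∞` bound `λ ‖v‖_∞ ≤ max |f − H(·, 0)|` for classical solutions of
`−μ_α v'' + H_α(y, v') + λ v = f` with Kirchhoff conditions. -/
theorem stmt_11 {I A : Type} [Fintype I] [Fintype A] [DecidableEq I]
    (N : Network I A) (μ : A → ℝ) (γ : I → A → ℝ)
    (hμ : ∀ α, 0 < μ α) (hγ : ∀ i : I, ∀ α ∈ N.edges i, 0 < γ i α)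
    (lam : ℝ) (hlam : 0 < lam)
    (H : A → ℝ → ℝ → ℝ)
    (hHcont : ∀ α, ContinuousOn (fun z : ℝ × ℝ => H α z.1 z.2)
      (Icc (0:ℝ) (N.ℓ α) ×ˢ (univ : Set ℝ)))
    (f : A → ℝ → ℝ) (hf : ∀ α, ContinuousOn (f α) (Icc (0:ℝ) (N.ℓ α)))
    (v v' v'' : A → ℝ → ℝ) (hv : Network.IsC2 N v v' v'')
    (hode : ∀ α : A, ∀ y ∈ Ioo (0:ℝ) (N.ℓ α),
      -(μ α * v'' α y) + H α y (v' α y) + lam * v α y = f α y)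
    (hkir : Network.Kirchhoff N μ γ v') :
    ∀ C : ℝ, (∀ α : A, ∀ y ∈ Icc (0:ℝ) (N.ℓ α), |f α y - H α y 0| ≤ C) →
      ∀ α : A, ∀ y ∈ Icc (0:ℝ) (N.ℓ α), lam * |v α y| ≤ C := by
  intro C hC α y hy
  have hupper : lam * v α y ≤ C :=
    Network.mul_le_of_source_le hμ hγ hlam hHcont hf hv hode hkir
      (fun β z hz => (abs_le.mp (hC β z hz)).2) α hy
  have hHneg : ∀ β, ContinuousOn (fun z : ℝ × ℝ => -H β z.1 (-z.2))
      (Icc (0:ℝ) (N.ℓ β) ×ˢ (univ : Set ℝ)) := fun β =>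
    ((hHcont β).comp (f := fun z : ℝ × ℝ => (z.1, -z.2)) (by fun_prop)
      fun z hz => ⟨hz.1, mem_univ _⟩).neg
  have hlower : lam * (-v) α y ≤ C := by
    refine Network.mul_le_of_source_le (H := fun β z p => -H β z (-p)) (f := -f) hμ hγ hlam
      hHneg (fun β => (hf β).neg) hv.neg (fun β z hz => ?_) hkir.neg (fun β z hz => ?_) α hy
    · simp only [Pi.neg_apply, neg_neg]
      linarith [hode β z hz]
    · simp only [Pi.neg_apply, neg_zero]
      linarith [(abs_le.mp (hC β z hz)).1]
  simp only [Pi.neg_apply] at hlower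
  rw [← abs_of_pos hlam, ← abs_mul, abs_le]
  constructor <;> linarith
end

section
/- Assume the Hamiltonian assumptions with constants q ∈ (1, 2] and C₀, C₁, C₂ > 0, and let F : [0, ∞) → ℝ be continuous, bounded from below (there is M > 0 with F(r) ≥ −M for all r ≥ 0), and strictly increasing. Then the stationary MFG system on Γ has at most one solution: if (v, m, ρ) and (ṽ, m̃, ρ̃) are both solutions, then ρ = ρ̃, v_α = ṽ_α and m_α = m̃_α on [0, ℓ_α] for every α ∈ 𝒜. -/
open Set

/-- The tangent line inequality for a convex function on `ℝ`. -/
theorem ConvexOn.add_mul_sub_le_of_hasDerivAt {h : ℝ → ℝ} {d p : ℝ} (hc : ConvexOn ℝ univ h)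
    (hd : HasDerivAt h d p) (r : ℝ) : h p + d * (r - p) ≤ h r := by
  rcases lt_trichotomy p r with hpr | rfl | hpr
  · have := hc.le_slope_of_hasDerivAt (mem_univ p) (mem_univ r) hpr hd
    rw [slope_def_field, le_div_iff₀ (by linarith)] at this
    linarith
  · simp
  · have := hc.slope_le_of_hasDerivAt (mem_univ r) (mem_univ p) hpr hd
    rw [slope_def_field, div_le_iff₀ (by linarith)] at this
    linarith

/-- A function on an interval whose derivative is dominated by a multiple of its absolute value
vanishes identically as soon as it vanishes at one point. -/
theorem eq_zero_of_abs_deriv_le {u u' : ℝ → ℝ} {K a b x : ℝ}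
    (hu : ∀ y ∈ Icc a b, HasDerivWithinAt u (u' y) (Icc a b) y)
    (hK : ∀ y ∈ Icc a b, |u' y| ≤ K * |u y|) (hx : x ∈ Icc a b) (hx0 : u x = 0) :
    ∀ y ∈ Icc a b, u y = 0 := by
  have hd : ∀ k : ℝ, ∀ y ∈ Icc a b, HasDerivWithinAt (fun t => u t ^ 2 * Real.exp (k * t))
      ((2 * u y * u' y + k * u y ^ 2) * Real.exp (k * y)) (Icc a b) y := by
    intro k y hy
    have h := ((hu y hy).pow 2).mul
      (((hasDerivAt_id y).const_mul k).exp.hasDerivWithinAt (s := Icc a b))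
    refine h.congr_deriv ?_
    simp only [id, Pi.pow_apply]
    push_cast
    ring
  have hcont : ∀ k : ℝ, ContinuousOn (fun t => u t ^ 2 * Real.exp (k * t)) (Icc a b) :=
    fun k y hy => (hd k y hy).continuousWithinAt
  have hbound : ∀ y ∈ Icc a b, |u y * u' y| ≤ K * u y ^ 2 := by
    intro y hy
    rw [abs_mul, ← sq_abs]
    nlinarith [hK y hy, abs_nonneg (u y)]
  have hzero : ∀ k y : ℝ, u y ^ 2 * Real.exp (k * y) ≤ u x ^ 2 * Real.exp (k * x) → u y = 0 := by
    intro k y h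
    rw [hx0] at h
    have h0 : u y ^ 2 ≤ 0 := by
      by_contra! hpos
      have := mul_pos hpos (Real.exp_pos (k * y))
      linarith
    exact pow_eq_zero_iff two_ne_zero |>.mp (le_antisymm h0 (sq_nonneg _))
  intro y hy
  rcases le_total x y with hxy | hxy
  · have hanti := antitoneOn_of_hasDerivWithinAt_nonpos (convex_Icc a b) (hcont (-2 * K))
      (fun t ht => (hd (-2 * K) t (interior_subset ht)).mono interior_subset)
      (fun t ht => mul_nonpos_of_nonpos_of_nonneg
        (by nlinarith [abs_le.mp (hbound t (interior_subset ht))]) (Real.exp_pos _).le)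
    exact hzero _ y (hanti hx hy hxy)
  · have hmono := monotoneOn_of_hasDerivWithinAt_nonneg (convex_Icc a b) (hcont (2 * K))
      (fun t ht => (hd (2 * K) t (interior_subset ht)).mono interior_subset)
      (fun t ht => mul_nonneg
        (by nlinarith [abs_le.mp (hbound t (interior_subset ht))]) (Real.exp_pos _).le)
    exact hzero _ y (hmono hy hx hxy)

/-- Nonzero functions whose derivative is dominated by their absolute value keep a strict sign. -/
theorem pos_of_abs_deriv_le {u u' : ℝ → ℝ} {K a b x : ℝ}
    (hu : ∀ y ∈ Icc a b, HasDerivWithinAt u (u' y) (Icc a b) y)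
    (hK : ∀ y ∈ Icc a b, |u' y| ≤ K * |u y|) (hx : x ∈ Icc a b) (hx0 : 0 < u x) :
    ∀ y ∈ Icc a b, 0 < u y := by
  intro y hy
  by_contra! hneg
  have hcont : ContinuousOn u (Icc a b) := fun t ht => (hu t ht).continuousWithinAt
  obtain ⟨z, hz, hz0⟩ := isPreconnected_Icc.intermediate_value hy hx hcont ⟨hneg, hx0.le⟩
  exact hx0.ne' (eq_zero_of_abs_deriv_le hu hK hz hz0 x hx)

/-- A function with positive slope at a point, whose slope satisfies a linear differential
inequality, is strictly larger at the right end than at the left end. -/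
theorem lt_of_abs_deriv_deriv_le {w u u' : ℝ → ℝ} {K a b x : ℝ} (hab : a < b)
    (hw : ∀ y ∈ Icc a b, HasDerivWithinAt w (u y) (Icc a b) y)
    (hu : ∀ y ∈ Icc a b, HasDerivWithinAt u (u' y) (Icc a b) y)
    (hK : ∀ y ∈ Icc a b, |u' y| ≤ K * |u y|) (hx : x ∈ Icc a b) (hx0 : 0 < u x) :
    w a < w b := by
  refine strictMonoOn_of_hasDerivWithinAt_pos (convex_Icc a b)
    (fun y hy => (hw y hy).continuousWithinAt)
    (fun y hy => (hw y (interior_subset hy)).mono interior_subset)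
    (fun y hy => pos_of_abs_deriv_le hu hK hx hx0 y (interior_subset hy))
    (left_mem_Icc.mpr hab.le) (right_mem_Icc.mpr hab.le) hab

/-- Continuous nonnegative functions on intervals whose integrals sum to zero all vanish. -/
theorem eq_zero_of_sum_integral_eq_zero {A : Type*} [Fintype A] {ℓ : A → ℝ} {g : A → ℝ → ℝ}
    (hℓ : ∀ α, 0 < ℓ α) (hg : ∀ α, ContinuousOn (g α) (Icc 0 (ℓ α)))
    (h0 : ∀ α, ∀ y ∈ Icc 0 (ℓ α), 0 ≤ g α y) (hsum : ∑ α, ∫ y in (0:ℝ)..(ℓ α), g α y = 0) :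
    ∀ α, ∀ y ∈ Icc 0 (ℓ α), g α y = 0 := by
  have hint : ∀ α ∈ Finset.univ, 0 ≤ ∫ y in (0:ℝ)..(ℓ α), g α y := fun α _ =>
    intervalIntegral.integral_nonneg (hℓ α).le (h0 α)
  intro α y hy
  by_contra hne
  have hpos := intervalIntegral.integral_pos (hℓ α) (hg α)
    (fun t ht => h0 α t (Ioc_subset_Icc_self ht)) ⟨y, hy, lt_of_le_of_ne (h0 α y hy) (Ne.symm hne)⟩
  exact hpos.ne' ((Finset.sum_eq_zero_iff_of_nonneg hint).mp hsum α (Finset.mem_univ α))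

namespace Network

variable {I A : Type} [Fintype I] [Fintype A] [DecidableEq I]

theorem src_mem_edges (N : Network I A) (α : A) : α ∈ N.edges (N.src α) := by
  simp [edges]

theorem tgt_mem_edges (N : Network I A) (α : A) : α ∈ N.edges (N.tgt α) := by
  simp [edges]

theorem mem_edges (N : Network I A) {i : I} {α : A} :
    α ∈ N.edges i ↔ N.src α = i ∨ N.tgt α = i := by
  simp [edges]

@[simp] theorem vval_src (N : Network I A) (f : A → ℝ → ℝ) (α : A) :
    N.vval f (N.src α) α = f α 0 := by
  simp [vval]

@[simp] theorem vval_tgt (N : Network I A) (f : A → ℝ → ℝ) (α : A) :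
    N.vval f (N.tgt α) α = f α (N.ℓ α) := by
  simp [vval, N.src_ne_tgt α]

@[simp] theorem oderiv_src (N : Network I A) (f : A → ℝ → ℝ) (α : A) :
    N.oderiv f (N.src α) α = -f α 0 := by
  simp [oderiv]

@[simp] theorem oderiv_tgt (N : Network I A) (f : A → ℝ → ℝ) (α : A) :
    N.oderiv f (N.tgt α) α = f α (N.ℓ α) := by
  simp [oderiv, N.src_ne_tgt α]

@[simp] theorem sgn_src (N : Network I A) (α : A) : N.sgn (N.src α) α = -1 := by
  simp [sgn]

@[simp] theorem sgn_tgt (N : Network I A) (α : A) : N.sgn (N.tgt α) α = 1 := by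
  simp [sgn, N.src_ne_tgt α]

/-- Summing over vertices and incident edges is summing over edges and their two endpoints. -/
theorem sum_edges (N : Network I A) (f : I → A → ℝ) :
    ∑ i, ∑ α ∈ N.edges i, f i α = ∑ α, (f (N.src α) α + f (N.tgt α) α) := by
  simp only [edges, Finset.sum_filter]
  rw [Finset.sum_comm]
  refine Finset.sum_congr rfl fun α _ => ?_
  have h : ∀ i, (if N.src α = i ∨ N.tgt α = i then f i α else 0)
      = (if N.src α = i then f i α else 0) + (if N.tgt α = i then f i α else 0) := by
    intro i
    have := N.src_ne_tgt α
    split_ifs <;> simp_all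
  simp [h, Finset.sum_add_distrib]

/-- A family of values that agree at each vertex comes from a function on the vertices. -/
theorem exists_vertex_value (N : Network I A) {f : I → A → ℝ}
    (hf : ∀ i, ∀ α ∈ N.edges i, ∀ β ∈ N.edges i, f i α = f i β) :
    ∃ W : I → ℝ, ∀ i, ∀ α ∈ N.edges i, f i α = W i := by
  classical
  refine ⟨fun i => if h : (N.edges i).Nonempty then f i h.choose else 0, fun i α hα => ?_⟩
  have h : (N.edges i).Nonempty := ⟨α, hα⟩
  simp only [h, dif_pos]
  exact hf i α hα _ h.choose_spec

/-- Integration by parts on the network: the boundary terms cancel for `w` satisfying the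
Kirchhoff conditions, `n` satisfying the jump conditions and a conserved flux `c`. -/
theorem sum_integral_eq_zero (N : Network I A) {μ c : A → ℝ} {γ : I → A → ℝ}
    {n n' w w' w'' : A → ℝ → ℝ} (hγ : ∀ i, ∀ α ∈ N.edges i, γ i α ≠ 0)
    (hw : IsC2 N w w' w'') (hK : Kirchhoff N μ γ w')
    (hn : ∀ α, ∀ y ∈ Icc (0:ℝ) (N.ℓ α), HasDerivWithinAt (n α) (n' α y) (Icc 0 (N.ℓ α)) y)
    (hn' : ∀ α, ContinuousOn (n' α) (Icc 0 (N.ℓ α)))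
    (hjump : ∀ i : I, ∀ α ∈ N.edges i, ∀ β ∈ N.edges i,
      N.vval n i α / γ i α = N.vval n i β / γ i β)
    (hc : ∀ i : I, ∑ α ∈ N.edges i, N.sgn i α * c α = 0) :
    ∑ α, ∫ y in (0:ℝ)..(N.ℓ α),
      (μ α * (n' α y * w' α y + n α y * w'' α y) - c α * w' α y) = 0 := by
  obtain ⟨hw1, hw2, hw3, hwv⟩ := hw
  obtain ⟨W, hW⟩ := N.exists_vertex_value hwv
  obtain ⟨κ, hκ⟩ := N.exists_vertex_value hjump
  have hbdry : ∀ i, ∑ α ∈ N.edges i,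
      (μ α * (N.vval n i α * N.oderiv w' i α) - N.sgn i α * c α * N.vval w i α) = 0 := by
    intro i
    have h : ∑ α ∈ N.edges i,
        (μ α * (N.vval n i α * N.oderiv w' i α) - N.sgn i α * c α * N.vval w i α)
        = ∑ α ∈ N.edges i,
          (κ i * (γ i α * μ α * N.oderiv w' i α) - N.sgn i α * c α * W i) := by
      refine Finset.sum_congr rfl fun α hα => ?_
      rw [hW i α hα, (div_eq_iff (hγ i α hα)).mp (hκ i α hα)]
      ring
    rw [h, Finset.sum_sub_distrib, ← Finset.mul_sum, ← Finset.sum_mul, hK i, hc i]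
    simp
  have hsum := N.sum_edges fun i α =>
    μ α * (N.vval n i α * N.oderiv w' i α) - N.sgn i α * c α * N.vval w i α
  rw [Finset.sum_eq_zero fun i _ => hbdry i] at hsum
  refine Eq.trans (Finset.sum_congr rfl fun α _ => ?_) hsum.symm
  have hd : ∀ y ∈ Icc (0:ℝ) (N.ℓ α), HasDerivWithinAt
      (fun t => μ α * (n α t * w' α t) - c α * w α t)
      (μ α * (n' α y * w' α y + n α y * w'' α y) - c α * w' α y) (Icc 0 (N.ℓ α)) y :=
    fun y hy => (((hn α y hy).mul (hw2 α y hy)).const_mul (μ α)).sub ((hw1 α y hy).const_mul (c α))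
  have hcn : ContinuousOn (n α) (Icc 0 (N.ℓ α)) := fun y hy => (hn α y hy).continuousWithinAt
  have hcw' : ContinuousOn (w' α) (Icc 0 (N.ℓ α)) := fun y hy => (hw2 α y hy).continuousWithinAt
  have hcont : ContinuousOn
      (fun y => μ α * (n' α y * w' α y + n α y * w'' α y) - c α * w' α y) (Icc 0 (N.ℓ α)) :=
    (continuousOn_const.mul (((hn' α).mul hcw').add (hcn.mul (hw3 α)))).sub
      (continuousOn_const.mul hcw')
  rw [intervalIntegral.integral_eq_sub_of_hasDerivAt_of_le (N.ℓ_pos α).le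
    (fun y hy => (hd y hy).continuousWithinAt)
    (fun y hy => (hd y (Ioo_subset_Icc_self hy)).hasDerivAt (Icc_mem_nhds hy.1 hy.2))
    (hcont.intervalIntegrable_of_Icc (N.ℓ_pos α).le)]
  simp only [vval_src, vval_tgt, oderiv_src, oderiv_tgt, sgn_src, sgn_tgt]
  ring

/-- Maximum principle: a solution of a homogeneous linear differential inequality for the slope
with Kirchhoff conditions is constant on the network. -/
theorem exists_eq_const_of_abs_le (N : Network I A) [Nonempty I] {μ : A → ℝ} {γ : I → A → ℝ}
    {w w' w'' : A → ℝ → ℝ} {K : A → ℝ} (hμ : ∀ α, 0 < μ α)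
    (hγ : ∀ i, ∀ α ∈ N.edges i, 0 < γ i α)
    (hw : IsC2 N w w' w'') (hKir : Kirchhoff N μ γ w')
    (hK : ∀ α, ∀ y ∈ Icc (0:ℝ) (N.ℓ α), |w'' α y| ≤ K α * |w' α y|) :
    ∃ k, ∀ α, ∀ y ∈ Icc (0:ℝ) (N.ℓ α), w α y = k := by
  obtain ⟨hw1, hw2, hw3, hwv⟩ := hw
  obtain ⟨W, hW⟩ := N.exists_vertex_value hwv
  obtain ⟨i₀, hi₀⟩ := Finite.exists_max W
  have hsrc : ∀ α, w α 0 = W (N.src α) := fun α => by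
    simpa using hW _ α (N.src_mem_edges α)
  have htgt : ∀ α, w α (N.ℓ α) = W (N.tgt α) := fun α => by
    simpa using hW _ α (N.tgt_mem_edges α)
  have hl : ∀ α, (0:ℝ) ∈ Icc (0:ℝ) (N.ℓ α) := fun α => left_mem_Icc.mpr (N.ℓ_pos α).le
  have hr : ∀ α, N.ℓ α ∈ Icc (0:ℝ) (N.ℓ α) := fun α => right_mem_Icc.mpr (N.ℓ_pos α).le
  have hlt : ∀ α, ∀ x ∈ Icc (0:ℝ) (N.ℓ α), 0 < w' α x → w α 0 < w α (N.ℓ α) :=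
    fun α x hx h => lt_of_abs_deriv_deriv_le (N.ℓ_pos α) (hw1 α) (hw2 α) (hK α) hx h
  have hgt : ∀ α, ∀ x ∈ Icc (0:ℝ) (N.ℓ α), w' α x < 0 → w α (N.ℓ α) < w α 0 := by
    intro α x hx h
    have := lt_of_abs_deriv_deriv_le (w := fun y => -w α y) (u := fun y => -w' α y)
      (u' := fun y => -w'' α y) (K := K α) (N.ℓ_pos α) (fun y hy => (hw1 α y hy).neg)
      (fun y hy => (hw2 α y hy).neg) (fun y hy => by simpa using hK α y hy) hx (by linarith)
    linarith
  have hnonneg : ∀ i, W i = W i₀ → ∀ α ∈ N.edges i, 0 ≤ N.oderiv w' i α := by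
    intro i hi α hα
    by_contra! hneg
    rcases N.mem_edges.mp hα with rfl | rfl
    · rw [oderiv_src] at hneg
      have := hlt α 0 (hl α) (by linarith)
      rw [hsrc, htgt, hi] at this
      exact absurd (hi₀ (N.tgt α)) (not_le.mpr this)
    · rw [oderiv_tgt] at hneg
      have := hgt α _ (hr α) hneg
      rw [hsrc, htgt, hi] at this
      exact absurd (hi₀ (N.src α)) (not_le.mpr this)
  have hconst : ∀ i, W i = W i₀ → ∀ α ∈ N.edges i, ∀ y ∈ Icc (0:ℝ) (N.ℓ α), w α y = W i₀ := by
    intro i hi α hα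
    have hpos : ∀ β ∈ N.edges i, 0 < γ i β * μ β := fun β hβ => mul_pos (hγ i β hβ) (hμ β)
    have h0 : N.oderiv w' i α = 0 := by
      have := (Finset.sum_eq_zero_iff_of_nonneg fun β hβ =>
        mul_nonneg (hpos β hβ).le (hnonneg i hi β hβ)).mp (hKir i) α hα
      exact (mul_eq_zero.mp this).resolve_left (hpos α hα).ne'
    have hex : ∃ x ∈ Icc (0:ℝ) (N.ℓ α), w' α x = 0 := by
      rcases N.mem_edges.mp hα with rfl | rfl
      · exact ⟨0, hl α, by simpa using h0⟩
      · exact ⟨_, hr α, by simpa using h0⟩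
    obtain ⟨x, hx, hx0⟩ := hex
    have hz := eq_zero_of_abs_deriv_le (hw2 α) (hK α) hx hx0
    have hc : ∀ y ∈ Icc (0:ℝ) (N.ℓ α), w α y = w α 0 :=
      constant_of_derivWithin_zero (fun y hy => (hw1 α y hy).differentiableWithinAt) fun y hy => by
        have hy' := Ico_subset_Icc_self hy
        rw [(hw1 α y hy').derivWithin (uniqueDiffOn_Icc (N.ℓ_pos α) y hy'), hz y hy']
    have hi0 : w α 0 = W i₀ := by
      rcases N.mem_edges.mp hα with rfl | rfl
      · rw [hsrc, hi]
      · rw [← hc _ (hr α), htgt, hi]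
    exact fun y hy => (hc y hy).trans hi0
  have hall : ∀ j, W j = W i₀ := by
    intro j
    induction N.connected i₀ j with
    | refl => rfl
    | tail _ hstep ih =>
      obtain ⟨α, ⟨rfl, rfl⟩ | ⟨rfl, rfl⟩⟩ := hstep
      · rw [← htgt]
        exact hconst _ ih α (N.src_mem_edges α) _ (hr α)
      · rw [← hsrc]
        exact hconst _ ih α (N.tgt_mem_edges α) _ (hl α)
  exact ⟨W i₀, fun α => hconst _ (hall _) α (N.src_mem_edges α)⟩

theorem IsC2.sub {N : Network I A} {v v' v'' w w' w'' : A → ℝ → ℝ}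
    (hv : IsC2 N v v' v'') (hw : IsC2 N w w' w'') :
    IsC2 N (fun α y => v α y - w α y) (fun α y => v' α y - w' α y)
      (fun α y => v'' α y - w'' α y) := by
  refine ⟨fun α y hy => (hv.1 α y hy).sub (hw.1 α y hy),
    fun α y hy => (hv.2.1 α y hy).sub (hw.2.1 α y hy),
    fun α => (hv.2.2.1 α).sub (hw.2.2.1 α), fun i α hα β hβ => ?_⟩
  have h1 := hv.2.2.2 i α hα β hβ
  have h2 := hw.2.2.2 i α hα β hβ
  simp only [vval] at *
  split_ifs at * <;> linarith

theorem Kirchhoff.sub {N : Network I A} {μ : A → ℝ} {γ : I → A → ℝ} {v' w' : A → ℝ → ℝ}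
    (hv : Kirchhoff N μ γ v') (hw : Kirchhoff N μ γ w') :
    Kirchhoff N μ γ (fun α y => v' α y - w' α y) := by
  intro i
  rw [← sub_zero (0:ℝ)]
  nth_rewrite 1 [← hv i]
  rw [← hw i, ← Finset.sum_sub_distrib]
  refine Finset.sum_congr rfl fun α _ => ?_
  simp only [oderiv]
  split_ifs <;> ring

/-- The difference of two Hamiltonian values along continuous slopes is controlled by the
difference of the slopes. -/
theorem HamHyp.exists_abs_sub_le {N : Network I A} {H Hp : A → ℝ → ℝ → ℝ} {q C₀ C₁ C₂ : ℝ}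
    (hH : HamHyp N H Hp q C₀ C₁ C₂) (hq : 1 ≤ q) (α : A) {p r : ℝ → ℝ}
    (hp : ContinuousOn p (Icc 0 (N.ℓ α))) (hr : ContinuousOn r (Icc 0 (N.ℓ α))) :
    ∃ K, ∀ y ∈ Icc (0:ℝ) (N.ℓ α), |H α y (p y) - H α y (r y)| ≤ K * |p y - r y| := by
  obtain ⟨-, hd, hconv, -, hgrowth⟩ := hH
  have hbound : ∀ s : ℝ → ℝ, ContinuousOn s (Icc 0 (N.ℓ α)) →
      ∃ B, ∀ y ∈ Icc (0:ℝ) (N.ℓ α), |Hp α y (s y)| ≤ B := by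
    intro s hs
    have hcont : ContinuousOn (fun y => C₂ * (|s y| ^ (q - 1) + 1)) (Icc 0 (N.ℓ α)) :=
      continuousOn_const.mul
        ((hs.abs.rpow_const fun _ _ => Or.inr (by linarith)).add continuousOn_const)
    obtain ⟨B, hB⟩ := isCompact_Icc.exists_bound_of_continuousOn hcont
    exact ⟨B, fun y hy => (hgrowth α y hy _).trans ((le_abs_self _).trans (hB y hy))⟩
  obtain ⟨B, hB⟩ := hbound p hp
  obtain ⟨D, hD⟩ := hbound r hr
  refine ⟨max B D, fun y hy => ?_⟩
  have h1 := (hconv α y hy).add_mul_sub_le_of_hasDerivAt (hd α y hy (p y)) (r y)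
  have h2 := (hconv α y hy).add_mul_sub_le_of_hasDerivAt (hd α y hy (r y)) (p y)
  have hmul : ∀ a : ℝ, |a| ≤ max B D → |a * (p y - r y)| ≤ max B D * |p y - r y| :=
    fun a ha => by
      rw [abs_mul]
      exact mul_le_mul_of_nonneg_right ha (abs_nonneg _)
  have h3 := abs_le.mp (hmul _ ((hB y hy).trans (le_max_left _ _)))
  have h4 := abs_le.mp (hmul _ ((hD y hy).trans (le_max_right _ _)))
  rw [abs_le]
  constructor <;> linarith

namespace IsMFGSolution

variable {N : Network I A} {μ : A → ℝ} {γ : I → A → ℝ} {H Hp : A → ℝ → ℝ → ℝ} {F : ℝ → ℝ}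
  {v v' v'' m m' : A → ℝ → ℝ} {ρ : ℝ}

/-- The Hamilton–Jacobi–Bellman equation holds up to the endpoints of each edge. -/
theorem hjb_on_Icc {q C₀ C₁ C₂ : ℝ} (hH : HamHyp N H Hp q C₀ C₁ C₂)
    (hF : ContinuousOn F (Ici 0)) (h : IsMFGSolution N μ γ H Hp F v v' v'' m m' ρ) (α : A) :
    ∀ y ∈ Icc (0:ℝ) (N.ℓ α), -(μ α * v'' α y) + H α y (v' α y) + ρ = F (m α y) := by
  obtain ⟨⟨-, hv2, hv3, -⟩, hhjb, -, hm, -, -, -, hm0, -⟩ := h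
  have hcv' : ContinuousOn (v' α) (Icc 0 (N.ℓ α)) := fun y hy => (hv2 α y hy).continuousWithinAt
  have hcm : ContinuousOn (m α) (Icc 0 (N.ℓ α)) := fun y hy => (hm α y hy).continuousWithinAt
  have hcH : ContinuousOn (fun y => H α y (v' α y)) (Icc 0 (N.ℓ α)) :=
    (hH.1 α).continuousOn.comp (continuousOn_id.prodMk hcv') fun y hy => ⟨hy, mem_univ _⟩
  have heq : EqOn (fun y => -(μ α * v'' α y) + H α y (v' α y) + ρ) (fun y => F (m α y))
      (Ioo 0 (N.ℓ α)) := hhjb α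
  exact heq.of_subset_closure
    (((continuousOn_const.mul (hv3 α)).neg.add hcH).add continuousOn_const)
    (hF.comp hcm fun y hy => hm0 α y hy) Ioo_subset_Icc_self
    (closure_Ioo (N.ℓ_pos α).ne).ge

end IsMFGSolution

end Network

/-- uniqueness of the solution of the stationary MFG system on the network
when the coupling `F` is continuous, bounded from below and strictly increasing. -/
theorem stmt_19 {I A : Type} [Fintype I] [Fintype A] [DecidableEq I]
    (N : Network I A) (μ : A → ℝ) (γ : I → A → ℝ)
    (hμ : ∀ α, 0 < μ α) (hγ : ∀ i : I, ∀ α ∈ N.edges i, 0 < γ i α)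
    (q C₀ C₁ C₂ M : ℝ) (hq1 : 1 < q) (hq2 : q ≤ 2)
    (hC₀ : 0 < C₀) (hC₁ : 0 < C₁) (hC₂ : 0 < C₂) (hM : 0 < M)
    (H Hp : A → ℝ → ℝ → ℝ) (hH : Network.HamHyp N H Hp q C₀ C₁ C₂)
    (F : ℝ → ℝ) (hFcont : ContinuousOn F (Ici (0:ℝ)))
    (hFbelow : ∀ r : ℝ, 0 ≤ r → -M ≤ F r)
    (hFmono : StrictMonoOn F (Ici (0:ℝ)))
    (v₁ v₁' v₁'' m₁ m₁' : A → ℝ → ℝ) (ρ₁ : ℝ)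
    (v₂ v₂' v₂'' m₂ m₂' : A → ℝ → ℝ) (ρ₂ : ℝ)
    (h₁ : Network.IsMFGSolution N μ γ H Hp F v₁ v₁' v₁'' m₁ m₁' ρ₁)
    (h₂ : Network.IsMFGSolution N μ γ H Hp F v₂ v₂' v₂'' m₂ m₂' ρ₂) :
    ρ₁ = ρ₂ ∧
    (∀ α : A, ∀ y ∈ Icc (0:ℝ) (N.ℓ α), v₁ α y = v₂ α y) ∧
    (∀ α : A, ∀ y ∈ Icc (0:ℝ) (N.ℓ α), m₁ α y = m₂ α y) := by
  have hhjb₁ := h₁.hjb_on_Icc hH hFcont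
  have hhjb₂ := h₂.hjb_on_Icc hH hFcont
  obtain ⟨hv₁, -, hK₁, hm₁, hm₁', hj₁, ⟨c₁, hc₁, hcs₁⟩, hm0₁, hmi₁, hvi₁⟩ := h₁
  obtain ⟨hv₂, -, hK₂, hm₂, hm₂', hj₂, ⟨c₂, hc₂, hcs₂⟩, hm0₂, hmi₂, hvi₂⟩ := h₂
  have hγ' : ∀ i, ∀ α ∈ N.edges i, γ i α ≠ 0 := fun i α hα => (hγ i α hα).ne'
  have hw := hv₁.sub hv₂
  have hKw := hK₁.sub hK₂
  have hcm₁ : ∀ α, ContinuousOn (m₁ α) (Icc 0 (N.ℓ α)) :=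
    fun α y hy => (hm₁ α y hy).continuousWithinAt
  have hcm₂ : ∀ α, ContinuousOn (m₂ α) (Icc 0 (N.ℓ α)) :=
    fun α y hy => (hm₂ α y hy).continuousWithinAt
  have hcv₁' : ∀ α, ContinuousOn (v₁' α) (Icc 0 (N.ℓ α)) :=
    fun α y hy => (hv₁.2.1 α y hy).continuousWithinAt
  have hcv₂' : ∀ α, ContinuousOn (v₂' α) (Icc 0 (N.ℓ α)) :=
    fun α y hy => (hv₂.2.1 α y hy).continuousWithinAt
  have hint : ∀ {f : ℝ → ℝ} {α : A}, ContinuousOn f (Icc 0 (N.ℓ α)) →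
      IntervalIntegrable f MeasureTheory.volume 0 (N.ℓ α) :=
    fun {f α} hf => hf.intervalIntegrable_of_Icc (N.ℓ_pos α).le
  have hgreen := N.sum_integral_eq_zero (μ := μ) (c := fun α => c₁ α - c₂ α)
    (n := fun α y => m₁ α y - m₂ α y) (n' := fun α y => m₁' α y - m₂' α y) hγ' hw hKw
    (fun α y hy => (hm₁ α y hy).sub (hm₂ α y hy)) (fun α => (hm₁' α).sub (hm₂' α))
    (fun i α hα β hβ => by
      have e₁ := hj₁ i α hα β hβ
      have e₂ := hj₂ i α hα β hβ
      simp only [Network.vval] at *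
      split_ifs at * <;> simp only [sub_div] <;> linarith)
    (fun i => by simp only [mul_sub, Finset.sum_sub_distrib, hcs₁ i, hcs₂ i, sub_zero])
  have hgreen₁ := N.sum_integral_eq_zero (μ := μ) (c := c₁) hγ' hw hKw hm₁ hm₁' hj₁ hcs₁
  have hcont : ∀ α, ContinuousOn (fun y => μ α * ((m₁' α y - m₂' α y) * (v₁' α y - v₂' α y)
      + (m₁ α y - m₂ α y) * (v₁'' α y - v₂'' α y)) - (c₁ α - c₂ α) * (v₁' α y - v₂' α y))
      (Icc 0 (N.ℓ α)) := fun α =>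
    (continuousOn_const.mul ((((hm₁' α).sub (hm₂' α)).mul ((hcv₁' α).sub (hcv₂' α))).add
      (((hcm₁ α).sub (hcm₂ α)).mul (hw.2.2.1 α)))).sub
      (continuousOn_const.mul ((hcv₁' α).sub (hcv₂' α)))
  have hcontρ : ∀ α, ContinuousOn (fun y => (ρ₁ - ρ₂) * (m₁ α y - m₂ α y)) (Icc 0 (N.ℓ α)) :=
    fun α => continuousOn_const.mul ((hcm₁ α).sub (hcm₂ α))
  -- the Lasry–Lions monotonicity identity, pointwise
  have hpoint : ∀ α, ∀ y ∈ Icc (0:ℝ) (N.ℓ α),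
      (ρ₁ - ρ₂) * (m₁ α y - m₂ α y) - (μ α * ((m₁' α y - m₂' α y) * (v₁' α y - v₂' α y)
        + (m₁ α y - m₂ α y) * (v₁'' α y - v₂'' α y)) - (c₁ α - c₂ α) * (v₁' α y - v₂' α y))
      = m₁ α y * (H α y (v₂' α y)
          - (H α y (v₁' α y) + Hp α y (v₁' α y) * (v₂' α y - v₁' α y)))
        + m₂ α y * (H α y (v₁' α y)
          - (H α y (v₂' α y) + Hp α y (v₂' α y) * (v₁' α y - v₂' α y)))
        + (m₁ α y - m₂ α y) * (F (m₁ α y) - F (m₂ α y)) := by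
    intro α y hy
    rw [← hc₁ α y hy, ← hc₂ α y hy, ← hhjb₁ α y hy, ← hhjb₂ α y hy]
    ring
  have hconv₁ : ∀ α, ∀ y ∈ Icc (0:ℝ) (N.ℓ α), 0 ≤ m₁ α y * (H α y (v₂' α y)
      - (H α y (v₁' α y) + Hp α y (v₁' α y) * (v₂' α y - v₁' α y))) := fun α y hy =>
    mul_nonneg (hm0₁ α y hy) (sub_nonneg.mpr
      ((hH.2.2.1 α y hy).add_mul_sub_le_of_hasDerivAt (hH.2.1 α y hy _) _))
  have hconv₂ : ∀ α, ∀ y ∈ Icc (0:ℝ) (N.ℓ α), 0 ≤ m₂ α y * (H α y (v₁' α y)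
      - (H α y (v₂' α y) + Hp α y (v₂' α y) * (v₁' α y - v₂' α y))) := fun α y hy =>
    mul_nonneg (hm0₂ α y hy) (sub_nonneg.mpr
      ((hH.2.2.1 α y hy).add_mul_sub_le_of_hasDerivAt (hH.2.1 α y hy _) _))
  have hF : ∀ α, ∀ y ∈ Icc (0:ℝ) (N.ℓ α),
      0 ≤ (m₁ α y - m₂ α y) * (F (m₁ α y) - F (m₂ α y)) := by
    intro α y hy
    rcases le_total (m₁ α y) (m₂ α y) with hle | hle
    · exact mul_nonneg_of_nonpos_of_nonpos (sub_nonpos.mpr hle)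
        (sub_nonpos.mpr (hFmono.monotoneOn (hm0₁ α y hy) (hm0₂ α y hy) hle))
    · exact mul_nonneg (sub_nonneg.mpr hle)
        (sub_nonneg.mpr (hFmono.monotoneOn (hm0₂ α y hy) (hm0₁ α y hy) hle))
  have hzero := eq_zero_of_sum_integral_eq_zero (g := fun α y =>
      (ρ₁ - ρ₂) * (m₁ α y - m₂ α y) - (μ α * ((m₁' α y - m₂' α y) * (v₁' α y - v₂' α y)
        + (m₁ α y - m₂ α y) * (v₁'' α y - v₂'' α y)) - (c₁ α - c₂ α) * (v₁' α y - v₂' α y)))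
    N.ℓ_pos (fun α => (hcontρ α).sub (hcont α))
    (fun α y hy => by
      simp only [hpoint α y hy]
      exact add_nonneg (add_nonneg (hconv₁ α y hy) (hconv₂ α y hy)) (hF α y hy))
    (by
      simp only [intervalIntegral.integral_sub (hint (hcontρ _)) (hint (hcont _)),
        Finset.sum_sub_distrib, hgreen, intervalIntegral.integral_const_mul,
        intervalIntegral.integral_sub (hint (hcm₁ _)) (hint (hcm₂ _)),
        ← Finset.mul_sum, hmi₁, hmi₂]
      ring)
  have hm : ∀ α, ∀ y ∈ Icc (0:ℝ) (N.ℓ α), m₁ α y = m₂ α y := by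
    intro α y hy
    have h := (hpoint α y hy).symm.trans (hzero α y hy)
    have h' : (m₁ α y - m₂ α y) * (F (m₁ α y) - F (m₂ α y)) = 0 := by
      linarith [hconv₁ α y hy, hconv₂ α y hy, hF α y hy]
    rcases mul_eq_zero.mp h' with h' | h'
    · exact sub_eq_zero.mp h'
    · exact hFmono.injOn (hm0₁ α y hy) (hm0₂ α y hy) (sub_eq_zero.mp h')
  have hρ : ρ₁ = ρ₂ := by
    have hρm : ∀ α, ∫ y in (0:ℝ)..(N.ℓ α), (μ α * (m₁' α y * (v₁' α y - v₂' α y)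
        + m₁ α y * (v₁'' α y - v₂'' α y)) - c₁ α * (v₁' α y - v₂' α y))
        = ∫ y in (0:ℝ)..(N.ℓ α), (ρ₁ - ρ₂) * m₁ α y := by
      intro α
      refine intervalIntegral.integral_congr fun y hy => ?_
      rw [uIcc_of_le (N.ℓ_pos α).le] at hy
      have h := (hpoint α y hy).symm.trans (hzero α y hy)
      have e₁ := hhjb₁ α y hy
      have e₂ := hhjb₂ α y hy
      rw [hm α y hy] at e₁
      have h' : m₁ α y * (H α y (v₂' α y)
          - (H α y (v₁' α y) + Hp α y (v₁' α y) * (v₂' α y - v₁' α y))) = 0 := by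
        linarith [hconv₁ α y hy, hconv₂ α y hy, hF α y hy]
      simp only [← hc₁ α y hy]
      linear_combination m₁ α y * (e₂ - e₁) - h'
    simp only [hρm, intervalIntegral.integral_const_mul, ← Finset.mul_sum, hmi₁] at hgreen₁
    linarith
  refine ⟨hρ, fun α => ?_, hm⟩
  have hlip : ∀ β, ∃ K, ∀ y ∈ Icc (0:ℝ) (N.ℓ β),
      |v₁'' β y - v₂'' β y| ≤ K * |v₁' β y - v₂' β y| := by
    intro β
    obtain ⟨K, hK⟩ := hH.exists_abs_sub_le hq1.le β (hcv₁' β) (hcv₂' β)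
    refine ⟨K / μ β, fun y hy => ?_⟩
    have e₁ := hhjb₁ β y hy
    have e₂ := hhjb₂ β y hy
    rw [hm β y hy] at e₁
    have h := hK y hy
    rw [show H β y (v₁' β y) - H β y (v₂' β y) = μ β * (v₁'' β y - v₂'' β y) by linarith,
      abs_mul, abs_of_pos (hμ β)] at h
    rw [div_mul_eq_mul_div, le_div_iff₀ (hμ β)]
    linarith
  choose K hK using hlip
  have : Nonempty I := ⟨N.src α⟩
  obtain ⟨k, hk⟩ := N.exists_eq_const_of_abs_le hμ hγ hw hKw hK
  have hk0 : k = 0 := by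
    have hsum : ∑ β, ∫ y in (0:ℝ)..(N.ℓ β), (v₁ β y - v₂ β y) = ∑ β, N.ℓ β * k := by
      refine Finset.sum_congr rfl fun β _ => ?_
      rw [intervalIntegral.integral_congr (g := fun _ => k) fun y hy => by
        rw [uIcc_of_le (N.ℓ_pos β).le] at hy
        exact hk β y hy]
      simp
    have hcv₁ : ∀ β, ContinuousOn (v₁ β) (Icc 0 (N.ℓ β)) :=
      fun β y hy => (hv₁.1 β y hy).continuousWithinAt
    have hcv₂ : ∀ β, ContinuousOn (v₂ β) (Icc 0 (N.ℓ β)) :=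
      fun β y hy => (hv₂.1 β y hy).continuousWithinAt
    simp only [intervalIntegral.integral_sub (hint (hcv₁ _)) (hint (hcv₂ _)),
      Finset.sum_sub_distrib, hvi₁, hvi₂, sub_zero, ← Finset.sum_mul] at hsum
    have hpos : 0 < ∑ β, N.ℓ β :=
      Finset.sum_pos (fun β _ => N.ℓ_pos β) ⟨α, Finset.mem_univ α⟩
    exact (mul_eq_zero.mp hsum.symm).resolve_left hpos.ne'
  exact fun y hy => sub_eq_zero.mp ((hk α y hy).trans hk0)
end
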